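/- Let γ be a topological embedding of the circle into ℝ³ with image K, and suppose D₀ > 0 is a real number such that dist_K(x,y) ≤ D₀·|x−y| for all x, y ∈ K (i.e. D₀ is a distortion bound for K). Then for every x ∈ ℝ³ and every r > 0, the 1-dimensional Hausdorff measure of K ∩ B̄(x,r) is at most 4·D₀·r, where B̄(x,r) is the closed ball of radius r about x. In particular, the conformal length of K is at most 4 times its distortion. -/

import Mathlib

open Metric Set Function MeasureTheory

/-- The intrinsic distance in a set `K ⊆ ℝ³`: the infimum, over all continuous paths
`σ : [0,1] → ℝ³` with image in `K` joining `x` to `y`, of the length (total variation)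
of `σ`; it takes values in `[0, ∞]` (`∞` if there is no such rectifiable path). -/
noncomputable def intrinsicDist (K : Set (EuclideanSpace ℝ (Fin 3)))
    (x y : EuclideanSpace ℝ (Fin 3)) : ENNReal :=
  ⨅ (σ : ℝ → EuclideanSpace ℝ (Fin 3)) (_ : ContinuousOn σ (Set.Icc 0 1))
    (_ : σ '' Set.Icc 0 1 ⊆ K) (_ : σ 0 = x) (_ : σ 1 = y),
    eVariationOn σ (Set.Icc 0 1)


lemma topo_arc {X : Type*} [TopologicalSpace X] [T2Space X] (f : ℝ → X) (a b : ℝ)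
    (hf : ContinuousOn f (Icc a b)) (hab : f a = f b) (hinj : InjOn f (Ico a b))
    (C : Set X) (hC : IsPreconnected C) (hCs : C ⊆ f '' Icc a b) (ha : f a ∈ C)
    (t : ℝ) (ht : t ∈ Icc a b) (hft : f t ∈ C) :
    f '' Icc a t ⊆ C ∨ f '' Icc t b ⊆ C := by
  by_contra hcon
  push Not at hcon
  obtain ⟨h1, h2⟩ := hcon
  rw [not_subset] at h1 h2
  obtain ⟨_, ⟨s, hs, rfl⟩, hsC⟩ := h1
  obtain ⟨_, ⟨u, hu, rfl⟩, huC⟩ := h2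
  have hsa : a < s := lt_of_le_of_ne hs.1 (by rintro rfl; exact hsC ha)
  have hst : s < t := lt_of_le_of_ne hs.2 (by rintro rfl; exact hsC hft)
  have hut : t < u := lt_of_le_of_ne hu.1 (by rintro rfl; exact huC hft)
  have hub : u < b := lt_of_le_of_ne hu.2 (by rintro rfl; exact huC (hab ▸ ha))
  have c1 : IsClosed (f '' Icc s u) :=
    (isCompact_Icc.image_of_continuousOn (hf.mono (Icc_subset_Icc (by linarith) (by linarith)))).isClosed
  have c2 : IsClosed (f '' (Icc a s ∪ Icc u b)) := by
    refine ((isCompact_Icc.union isCompact_Icc).image_of_continuousOn (hf.mono ?_)).isClosed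
    exact union_subset (Icc_subset_Icc (by linarith) (by linarith))
      (Icc_subset_Icc (by linarith) (by linarith))
  obtain ⟨z, hzC, ⟨v, hv, hvz⟩, ⟨w, hw, hwz⟩⟩ := isPreconnected_closed_iff.1 hC _ _ c1 c2 (by
    intro z hz
    obtain ⟨v, hv, rfl⟩ := hCs hz
    rcases le_total v s with h | h
    · exact Or.inr ⟨v, Or.inl ⟨hv.1, h⟩, rfl⟩
    rcases le_total v u with h' | h'
    · exact Or.inl ⟨v, ⟨h, h'⟩, rfl⟩
    · exact Or.inr ⟨v, Or.inr ⟨h', hv.2⟩, rfl⟩)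
    ⟨f t, hft, t, ⟨hst.le, hut.le⟩, rfl⟩ ⟨f a, ha, a, Or.inl ⟨le_rfl, hsa.le⟩, rfl⟩
  have hvs : s ≠ v := by rintro rfl; exact hsC (hvz ▸ hzC)
  have hvu : v ≠ u := by rintro rfl; exact huC (hvz ▸ hzC)
  have hv1 := lt_of_le_of_ne hv.1 hvs
  have hv2 := lt_of_le_of_ne hv.2 hvu
  rcases hw with hw | hw
  · have := hinj ⟨by linarith, by linarith⟩ ⟨hw.1, by linarith [hw.2]⟩ (hvz.trans hwz.symm)
    linarith [hw.2]
  · rcases eq_or_lt_of_le hw.2 with h | h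
    · have := hinj (x₁ := v) (x₂ := a) ⟨by linarith, by linarith⟩ ⟨le_rfl, by linarith⟩
        (by rw [hvz, hab, ← h, hwz])
      linarith
    · have := hinj (x₁ := v) ⟨by linarith, by linarith⟩ ⟨by linarith [hw.1], h⟩ (hvz.trans hwz.symm)
      linarith [hw.1]

lemma nested_meas {X : Type*} [MeasurableSpace X] (μ : Measure X) (f : ℝ → X) (a b : ℝ)
    (d : ENNReal) :
    μ (f '' {t | t ∈ Icc a b ∧ μ (f '' Icc a t) ≤ d}) ≤ d := by
  set S := {t | t ∈ Icc a b ∧ μ (f '' Icc a t) ≤ d} with hS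
  rcases S.eq_empty_or_nonempty with h | hne
  · simp [h]
  have hbd : BddAbove S := ⟨b, fun t ht => ht.1.2⟩
  by_cases hm : sSup S ∈ S
  · refine (measure_mono (image_mono ?_)).trans hm.2
    exact fun t ht => ⟨ht.1.1, le_csSup hbd ht⟩
  · obtain ⟨u, hu, hut, huS⟩ := exists_seq_tendsto_sSup hne hbd
    have hmono : Monotone fun n => f '' Icc a (u n) :=
      fun m n h => image_mono (Icc_subset_Icc le_rfl (hu h))
    have : f '' S ⊆ ⋃ n, f '' Icc a (u n) := by
      rintro _ ⟨t, ht, rfl⟩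
      have hlt : t < sSup S := lt_of_le_of_ne (le_csSup hbd ht) (by rintro rfl; exact hm ht)
      obtain ⟨n, hn⟩ := (hut.eventually (lt_mem_nhds hlt)).exists
      exact mem_iUnion.2 ⟨n, t, ⟨ht.1.1, hn.le⟩, rfl⟩
    refine (measure_mono this).trans ?_
    rw [hmono.measure_iUnion]
    exact iSup_le fun n => (huS n).2

lemma nested_meas' {X : Type*} [MeasurableSpace X] (μ : Measure X) (f : ℝ → X) (a b : ℝ)
    (d : ENNReal) :
    μ (f '' {t | t ∈ Icc a b ∧ μ (f '' Icc t b) ≤ d}) ≤ d := by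
  refine le_trans (measure_mono ?_) (nested_meas μ (fun t => f (-t)) (-b) (-a) d)
  rintro _ ⟨t, ht, rfl⟩
  refine ⟨-t, ⟨⟨neg_le_neg ht.1.2, neg_le_neg ht.1.1⟩, ?_⟩, by simp⟩
  refine le_trans (measure_mono ?_) ht.2
  rintro _ ⟨v, hv, rfl⟩
  exact ⟨-v, ⟨by linarith [hv.2], by linarith [hv.1]⟩, rfl⟩

lemma circ_inj {x y c : ℝ} (hx : x ∈ Ico c (c + 2 * Real.pi)) (hy : y ∈ Ico c (c + 2 * Real.pi))
    (h1 : Real.cos x = Real.cos y) (h2 : Real.sin x = Real.sin y) : x = y := by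
  have h := Real.Angle.cos_sin_inj h1 h2
  rw [Real.Angle.angle_eq_iff_two_pi_dvd_sub] at h
  obtain ⟨k, hk⟩ := h
  have hpi := Real.pi_pos
  have k1 : (k : ℝ) < 1 := by by_contra! hh; nlinarith [hx.1, hx.2, hy.1, hy.2]
  have k2 : (-1 : ℝ) < k := by by_contra! hh; nlinarith [hx.1, hx.2, hy.1, hy.2]
  have : k = 0 := by
    have : k < 1 := by exact_mod_cast k1
    have : -1 < k := by exact_mod_cast k2
    omega
  subst this
  simp at hk; linarith

lemma circ_surj {x y : ℝ} (c : ℝ) (h : x ^ 2 + y ^ 2 = 1) :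
    ∃ t ∈ Ico c (c + 2 * Real.pi), Real.cos t = x ∧ Real.sin t = y := by
  have hn : ‖(⟨x, y⟩ : ℂ)‖ = 1 := by
    rw [← sq_eq_sq₀ (norm_nonneg _) zero_le_one, Complex.sq_norm, Complex.normSq_mk]; linarith
  have h0 : (⟨x, y⟩ : ℂ) ≠ 0 := by intro h; simp [h] at hn
  refine ⟨toIcoMod Real.two_pi_pos c (Complex.arg ⟨x, y⟩), toIcoMod_mem_Ico _ _ _, ?_, ?_⟩
  · rw [toIcoMod, zsmul_eq_mul, Real.cos_sub_int_mul_two_pi, Complex.cos_arg h0, hn]; simp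
  · rw [toIcoMod, zsmul_eq_mul, Real.sin_sub_int_mul_two_pi, Complex.sin_arg, hn]; simp

lemma haus_le_var {X : Type*} [MetricSpace X] [MeasurableSpace X] [BorelSpace X]
    (σ : ℝ → X) (hσ : ContinuousOn σ (Icc 0 1)) :
    Measure.hausdorffMeasure 1 (σ '' Icc 0 1) ≤ eVariationOn σ (Icc 0 1) := by
  have huc : UniformContinuousOn σ (Icc 0 1) := isCompact_Icc.uniformContinuousOn_of_continuous hσ
  rw [Metric.uniformContinuousOn_iff] at huc
  have hN : ∀ n : ℕ, ∃ N : ℕ, 0 < N ∧ ∀ i : Fin N,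
      ediam (σ '' Icc ((i : ℕ) / (N : ℝ)) (((i : ℕ) + 1 : ℕ) / (N : ℝ))) ≤
        ENNReal.ofReal (1 / ((n : ℝ) + 1)) := by
    intro n
    obtain ⟨δ, hδ, h⟩ := huc (1 / ((n : ℝ) + 1)) (by positivity)
    obtain ⟨N, hN⟩ := exists_nat_one_div_lt hδ
    refine ⟨N + 1, by omega, fun i => ediam_le ?_⟩
    have hNp : (0 : ℝ) < ((N + 1 : ℕ) : ℝ) := by positivity
    have hsub : ∀ x ∈ Icc ((i : ℕ) / ((N + 1 : ℕ) : ℝ)) (((i : ℕ) + 1 : ℕ) / ((N + 1 : ℕ) : ℝ)),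
        x ∈ Icc (0 : ℝ) 1 := by
      intro x hx
      refine ⟨le_trans (by positivity) hx.1, hx.2.trans ?_⟩
      rw [div_le_one hNp]
      exact_mod_cast i.2
    rintro _ ⟨x, hx, rfl⟩ _ ⟨y, hy, rfl⟩
    rw [edist_dist]
    refine ENNReal.ofReal_le_ofReal (h x (hsub x hx) y (hsub y hy) ?_).le
    refine lt_of_le_of_lt (Real.dist_le_of_mem_Icc hx hy) (lt_of_le_of_lt (le_of_eq ?_) hN)
    push_cast
    field_simp
    ring
  choose N hNpos hN using hN
  have key := Measure.hausdorffMeasure_le_liminf_sum (ι := fun n => Fin (N n)) 1 (σ '' Icc 0 1)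
    (l := Filter.atTop) (fun n : ℕ => ENNReal.ofReal (1 / ((n : ℝ) + 1)))
    (by
      have := ENNReal.tendsto_ofReal (tendsto_one_div_add_atTop_nhds_zero_nat (𝕜 := ℝ))
      simpa using this)
    (fun n i => σ '' Icc ((i : ℕ) / (N n : ℝ)) (((i : ℕ) + 1 : ℕ) / (N n : ℝ)))
    (Filter.Eventually.of_forall fun n i => hN n i)
    (Filter.Eventually.of_forall fun n => by
      rintro _ ⟨x, hx, rfl⟩
      have hp : (0 : ℝ) < N n := by exact_mod_cast hNpos n
      rcases eq_or_lt_of_le hx.2 with h1 | h1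
      · refine mem_iUnion.2 ⟨⟨N n - 1, by have := hNpos n; omega⟩, x, ⟨?_, ?_⟩, rfl⟩
        · rw [h1, div_le_one hp]; exact_mod_cast Nat.sub_le _ _
        · have : N n - 1 + 1 = N n := by have := hNpos n; omega
          simp only [this]
          rw [div_self hp.ne', h1]
      · have hx0 : 0 ≤ x * N n := mul_nonneg hx.1 hp.le
        refine mem_iUnion.2 ⟨⟨⌊x * N n⌋₊, ?_⟩, x, ⟨?_, ?_⟩, rfl⟩
        · rw [Nat.floor_lt hx0]; nlinarith
        · rw [div_le_iff₀ hp]; exact Nat.floor_le hx0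
        · rw [le_div_iff₀ hp]; push_cast; exact (Nat.lt_floor_add_one _).le)
  refine key.trans ?_
  refine (Filter.liminf_le_liminf (v := fun _ => eVariationOn σ (Icc 0 1))
    (Filter.Eventually.of_forall fun n => ?_)).trans (Filter.liminf_const _).le
  have hp : (0 : ℝ) < N n := by exact_mod_cast hNpos n
  have hs := eVariationOn.sum' σ (I := fun i : ℕ => (i : ℝ) / (N n : ℝ))
    (fun i j h => by dsimp only; gcongr) (n := N n)
  simp only [Nat.cast_zero, zero_div, div_self hp.ne'] at hs
  rw [← hs, ← Fin.sum_univ_eq_sum_range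
    (fun i => eVariationOn σ (Icc ((i : ℝ) / (N n : ℝ)) (((i + 1 : ℕ) : ℝ) / (N n : ℝ))))]
  refine Finset.sum_le_sum fun i _ => ?_
  rw [ENNReal.rpow_one]
  refine ediam_le ?_
  rintro _ ⟨x, hx, rfl⟩ _ ⟨y, hy, rfl⟩
  exact eVariationOn.edist_le σ hx hy

/-- Standard parametrization of the circle. -/
noncomputable def circPar (t : ℝ) : Metric.sphere (0 : EuclideanSpace ℝ (Fin 2)) 1 :=
  ⟨!₂[Real.cos t, Real.sin t], by
    simp [EuclideanSpace.norm_eq, Fin.sum_univ_two]⟩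

lemma circPar_cont : Continuous circPar := by
  unfold circPar
  refine Continuous.subtype_mk ?_ _
  fun_prop

lemma circPar_surj (c : ℝ) (z : Metric.sphere (0 : EuclideanSpace ℝ (Fin 2)) 1) :
    ∃ t ∈ Ico c (c + 2 * Real.pi), circPar t = z := by
  obtain ⟨z, hz⟩ := z
  have h : (z 0) ^ 2 + (z 1) ^ 2 = 1 := by
    have := mem_sphere_zero_iff_norm.1 hz
    have h2 := EuclideanSpace.real_norm_sq_eq z
    rw [this, Fin.sum_univ_two] at h2
    linarith
  obtain ⟨t, ht, h1, h2⟩ := circ_surj c h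
  refine ⟨t, ht, Subtype.ext ?_⟩
  ext i
  fin_cases i
  · simpa [circPar] using h1
  · simpa [circPar] using h2

lemma circPar_inj (c : ℝ) : InjOn circPar (Ico c (c + 2 * Real.pi)) := by
  intro x hx y hy h
  have h' := congrArg Subtype.val h
  have h1 := congrArg (fun v : EuclideanSpace ℝ (Fin 2) => v 0) h'
  have h2 := congrArg (fun v : EuclideanSpace ℝ (Fin 2) => v 1) h'
  exact circ_inj hx hy (by simpa [circPar] using h1) (by simpa [circPar] using h2)

/-- Let `γ` be a topological embedding of the circle into `ℝ³` with
image `K`, and let `D₀ > 0` satisfy `dist_K(x, y) ≤ D₀ * |x - y|` for all `x, y ∈ K`.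
Then for every `x ∈ ℝ³` and `r > 0`, the 1-dimensional Hausdorff measure of
`K ∩ B̄(x, r)` is at most `4 * D₀ * r`; in particular the conformal length of `K` is at
most `4` times its distortion. -/
theorem statement18
    (γ : (Metric.sphere (0 : EuclideanSpace ℝ (Fin 2)) 1) → EuclideanSpace ℝ (Fin 3))
    (hγc : Continuous γ) (hγinj : Function.Injective γ)
    (D₀ : ℝ) (hD₀ : 0 < D₀)
    (hdist : ∀ x ∈ Set.range γ, ∀ y ∈ Set.range γ,
      intrinsicDist (Set.range γ) x y ≤ ENNReal.ofReal (D₀ * dist x y)) :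
    ∀ (x : EuclideanSpace ℝ (Fin 3)) (r : ℝ), 0 < r →
      MeasureTheory.Measure.hausdorffMeasure 1
          (Set.range γ ∩ Metric.closedBall x r) ≤
        ENNReal.ofReal (4 * D₀ * r) := by
  intro x r hr
  set μ : Measure (EuclideanSpace ℝ (Fin 3)) := Measure.hausdorffMeasure 1 with hμ
  rcases (Set.range γ ∩ Metric.closedBall x r).eq_empty_or_nonempty with h | ⟨p, ⟨z, rfl⟩, hpx⟩
  · simp [h]
  obtain ⟨c, -, rfl⟩ := circPar_surj 0 z
  set f : ℝ → EuclideanSpace ℝ (Fin 3) := fun t => γ (circPar t) with hf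
  set b := c + 2 * Real.pi with hb
  have hcb : c ≤ b := by have := Real.pi_pos; linarith
  have hfc : Continuous f := hγc.comp circPar_cont
  have hfab : f c = f b := by
    simp [hf, hb, circPar]
  have hfinj : InjOn f (Ico c b) := hγinj.comp_injOn (circPar_inj c)
  have hran : Set.range γ ⊆ f '' Icc c b := by
    rintro _ ⟨w, rfl⟩
    obtain ⟨t, ht, rfl⟩ := circPar_surj c w
    exact ⟨t, Ico_subset_Icc_self ht, rfl⟩
  have main : ∀ d : ENNReal, ENNReal.ofReal (D₀ * (2 * r)) < d →
      μ (Set.range γ ∩ Metric.closedBall x r) ≤ d + d := by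
    intro d hd
    have hsub : Set.range γ ∩ Metric.closedBall x r ⊆
        (f '' {t | t ∈ Icc c b ∧ μ (f '' Icc c t) ≤ d}) ∪
        (f '' {t | t ∈ Icc c b ∧ μ (f '' Icc t b) ≤ d}) := by
      rintro q ⟨hq, hqx⟩
      have hdq : dist (f c) q ≤ 2 * r := by
        have := dist_triangle_right (f c) q x
        have h1 := mem_closedBall.1 hpx
        have h2 := mem_closedBall.1 hqx
        change dist (f c) x ≤ r at h1
        linarith
      have hlt : intrinsicDist (Set.range γ) (f c) q < d :=
        lt_of_le_of_lt ((hdist _ ⟨_, rfl⟩ _ hq).trans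
          (ENNReal.ofReal_le_ofReal (by gcongr))) hd
      simp only [intrinsicDist, iInf_lt_iff] at hlt
      obtain ⟨σ, hσ, hσK, h0, h1, hv⟩ := hlt
      obtain ⟨t, ht, rfl⟩ := hran hq
      have hm : μ (σ '' Icc 0 1) ≤ d := (haus_le_var σ hσ).trans hv.le
      rcases topo_arc f c b hfc.continuousOn hfab hfinj (σ '' Icc 0 1)
        (isPreconnected_Icc.image σ hσ) (hσK.trans hran) ⟨0, by simp, h0⟩ t ht
        ⟨1, by simp, h1⟩ with h | h
      · exact Or.inl ⟨t, ⟨ht, (measure_mono h).trans hm⟩, rfl⟩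
      · exact Or.inr ⟨t, ⟨ht, (measure_mono h).trans hm⟩, rfl⟩
    exact (measure_mono hsub).trans ((measure_union_le _ _).trans
      (add_le_add (nested_meas μ f c b d) (nested_meas' μ f c b d)))
  refine ENNReal.le_of_forall_pos_le_add fun ε hε _ => ?_
  refine (main (ENNReal.ofReal (D₀ * (2 * r) + ε / 2)) ?_).trans ?_
  · rw [ENNReal.ofReal_lt_ofReal_iff] <;> · have : (0 : ℝ) < ε := hε; 
                                             first | linarith | positivity
  · have hε' : (0 : ℝ) < ε := hε
    rw [← ENNReal.ofReal_add (by positivity) (by positivity), ← ENNReal.ofReal_coe_nnreal,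
      ← ENNReal.ofReal_add (by positivity) (by positivity)]
    exact ENNReal.ofReal_le_ofReal (by linarith)
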